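/- arXiv:2007.09986 — 4 statements merged into one kernel-verified Lean document; each statement's English description precedes it below -/
import Mathlib

section
/- Let p, q, r, α, β be real numbers with q ≠ 0, r ≠ 0 and (α² + p)/(−r) > 0, and set k = (1/2)·√((α² + p)/(−r)) and A = −3(α² + p)/(2q). Then the function u(x,t) = A·sech²(k(x + αt) + β) satisfies the Boussinesq equation ∂²u/∂t² + p·∂²u/∂x² + q·∂²(u²)/∂x² + r·∂⁴u/∂x⁴ = 0 for all real x and t. -/
theorem hasDerivAt_sech_sq_affine (a b x : ℝ) :
    HasDerivAt (fun y => (1 / Real.cosh (a * y + b)) ^ 2)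
      (-2 * a * (1 / Real.cosh (a * x + b)) ^ 2 * Real.tanh (a * x + b)) x := by
  have hc : Real.cosh (a * x + b) ≠ 0 := (Real.cosh_pos _).ne'
  have hl : HasDerivAt (fun y => a * y + b) a x := by
    simpa using ((hasDerivAt_id x).const_mul a).add_const b
  have h := (hl.cosh.fun_inv hc).fun_pow 2
  simp only [one_div]
  refine h.congr_deriv ?_
  rw [Real.tanh_eq_sinh_div_cosh]
  norm_num
  field_simp

theorem hasDerivAt_tanh_affine (a b x : ℝ) :
    HasDerivAt (fun y => Real.tanh (a * y + b))
      (a * (1 / Real.cosh (a * x + b)) ^ 2) x := by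
  have hc : Real.cosh (a * x + b) ≠ 0 := (Real.cosh_pos _).ne'
  have hl : HasDerivAt (fun y => a * y + b) a x := by
    simpa using ((hasDerivAt_id x).const_mul a).add_const b
  have h := hl.sinh.fun_div hl.cosh hc
  simp only [Real.tanh_eq_sinh_div_cosh]
  refine h.congr_deriv ?_
  field_simp
  linear_combination a * Real.cosh_sq (a * x + b)

theorem tanh_sq_eq_one_sub_sech_sq (z : ℝ) :
    Real.tanh z ^ 2 = 1 - (1 / Real.cosh z) ^ 2 := by
  have hc : Real.cosh z ≠ 0 := (Real.cosh_pos _).ne'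
  rw [Real.tanh_eq_sinh_div_cosh]
  field_simp
  linear_combination -Real.cosh_sq z

theorem iteratedDeriv_two_quadratic_sech_sq (a b m n : ℝ) :
    iteratedDeriv 2 (fun y => m * (1 / Real.cosh (a * y + b)) ^ 2
        + n * ((1 / Real.cosh (a * y + b)) ^ 2) ^ 2)
      = fun y => a ^ 2 * (4 * m * (1 / Real.cosh (a * y + b)) ^ 2
        + (16 * n - 6 * m) * ((1 / Real.cosh (a * y + b)) ^ 2) ^ 2
        - 20 * n * ((1 / Real.cosh (a * y + b)) ^ 2) ^ 3) := by
  have hS := hasDerivAt_sech_sq_affine a b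
  have hT := hasDerivAt_tanh_affine a b
  have h1 : deriv (fun y => m * (1 / Real.cosh (a * y + b)) ^ 2
        + n * ((1 / Real.cosh (a * y + b)) ^ 2) ^ 2)
      = fun y => (-2 * a) * ((m * (1 / Real.cosh (a * y + b)) ^ 2
        + 2 * n * ((1 / Real.cosh (a * y + b)) ^ 2) ^ 2) * Real.tanh (a * y + b)) := by
    funext y
    refine ((((hS y).const_mul m).fun_add (((hS y).fun_pow 2).const_mul n)).congr_deriv ?_).deriv
    push_cast
    ring
  rw [iteratedDeriv_succ, iteratedDeriv_one, h1]
  funext y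
  refine ((((((hS y).const_mul m).fun_add (((hS y).fun_pow 2).const_mul (2 * n))).fun_mul
    (hT y)).const_mul (-2 * a)).congr_deriv ?_).deriv
  have ht := tanh_sq_eq_one_sub_sech_sq (a * y + b)
  generalize (1 / Real.cosh (a * y + b)) ^ 2 = S at *
  generalize Real.tanh (a * y + b) = T at *
  push_cast
  linear_combination (4 * a ^ 2 * (m * S + 4 * n * S ^ 2)) * ht

theorem iteratedDeriv_two_sech_sq (a b m : ℝ) :
    iteratedDeriv 2 (fun y => m * (1 / Real.cosh (a * y + b)) ^ 2)
      = fun y => (4 * a ^ 2 * m) * (1 / Real.cosh (a * y + b)) ^ 2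
        + (-6 * a ^ 2 * m) * ((1 / Real.cosh (a * y + b)) ^ 2) ^ 2 := by
  have h := iteratedDeriv_two_quadratic_sech_sq a b m 0
  simp only [zero_mul, add_zero] at h
  rw [h]
  funext y
  ring

theorem iteratedDeriv_two_sq_sech_sq (a b m : ℝ) :
    iteratedDeriv 2 (fun y => (m * (1 / Real.cosh (a * y + b)) ^ 2) ^ 2)
      = fun y => a ^ 2 * m ^ 2 * (16 * ((1 / Real.cosh (a * y + b)) ^ 2) ^ 2
        - 20 * ((1 / Real.cosh (a * y + b)) ^ 2) ^ 3) := by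
  have h := iteratedDeriv_two_quadratic_sech_sq a b 0 (m ^ 2)
  simp only [zero_mul, zero_add] at h
  simp only [mul_pow m]
  rw [h]
  funext y
  ring

theorem iteratedDeriv_four_sech_sq (a b m : ℝ) :
    iteratedDeriv 4 (fun y => m * (1 / Real.cosh (a * y + b)) ^ 2)
      = fun y => a ^ 4 * m * (16 * (1 / Real.cosh (a * y + b)) ^ 2
        - 120 * ((1 / Real.cosh (a * y + b)) ^ 2) ^ 2
        + 120 * ((1 / Real.cosh (a * y + b)) ^ 2) ^ 3) := by
  have h4 (f : ℝ → ℝ) : iteratedDeriv 4 f = iteratedDeriv 2 (iteratedDeriv 2 f) := by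
    simp only [iteratedDeriv_eq_iterate, ← Function.iterate_add_apply]
  rw [h4, iteratedDeriv_two_sech_sq, iteratedDeriv_two_quadratic_sech_sq]
  funext y
  ring

/-- The sech²-solitary wave solves the Boussinesq equation
    u_tt + p u_xx + q (u²)_xx + r u_xxxx = 0. -/
theorem boussinesq_sech_sq_solution
    (p q r α β : ℝ) (hq : q ≠ 0) (hr : r ≠ 0)
    (hpr : (α ^ 2 + p) / (-r) > 0)
    (k A : ℝ)
    (hk : k = (1 / 2) * Real.sqrt ((α ^ 2 + p) / (-r)))
    (hA : A = -(3 * (α ^ 2 + p)) / (2 * q))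
    (u : ℝ → ℝ → ℝ)
    (hu : ∀ x t, u x t = A * (1 / Real.cosh (k * (x + α * t) + β)) ^ 2) :
    ∀ x t : ℝ,
      iteratedDeriv 2 (fun t' => u x t') t
        + p * iteratedDeriv 2 (fun x' => u x' t) x
        + q * iteratedDeriv 2 (fun x' => (u x' t) ^ 2) x
        + r * iteratedDeriv 4 (fun x' => u x' t) x = 0 := by
  intro x t
  have hx (x' : ℝ) : k * (x' + α * t) + β = k * x' + (k * α * t + β) := by ring
  have ht (t' : ℝ) : k * (x + α * t') + β = (k * α) * t' + (k * x + β) := by ring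
  have hut : (fun t' => u x t') =
      fun t' => A * (1 / Real.cosh ((k * α) * t' + (k * x + β))) ^ 2 := by
    funext t'
    rw [hu, ht]
  have hux (x' : ℝ) : u x' t = A * (1 / Real.cosh (k * x' + (k * α * t + β))) ^ 2 := by
    rw [hu, hx]
  have hz : (k * α) * t + (k * x + β) = k * x + (k * α * t + β) := by ring
  simp only [hut, hux, iteratedDeriv_two_sech_sq, iteratedDeriv_two_sq_sech_sq,
    iteratedDeriv_four_sech_sq, hz]
  generalize (1 / Real.cosh (k * x + (k * α * t + β))) ^ 2 = S
  have hk2 : 4 * r * k ^ 2 = -(α ^ 2 + p) := by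
    rw [hk, mul_pow, Real.sq_sqrt hpr.le]
    field_simp
    norm_num
  have hA2 : 2 * q * A = -(3 * (α ^ 2 + p)) := by
    rw [hA]
    field_simp
  linear_combination (A * k ^ 2 * (4 * S - 30 * S ^ 2 + 30 * S ^ 3)) * hk2
    + (A * k ^ 2 * (8 * S ^ 2 - 10 * S ^ 3)) * hA2
end

section
/- Let c be a real number with 0 < c < 1. Then the function u(x,t) = (c/2)·sech²[(√c/2)·(x − √(1−c)·t + 1)] satisfies the Boussinesq equation ∂²u/∂t² − ∂²u/∂x² + 3·∂²(u²)/∂x² + ∂⁴u/∂x⁴ = 0 for all real x and t. -/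
lemma hasDerivAt_sech_affine_pow (a b z : ℝ) (n : ℕ) :
    HasDerivAt (fun z => (1 / Real.cosh (a * z + b)) ^ n)
      (-(n * a) * (Real.sinh (a * z + b) * (1 / Real.cosh (a * z + b)) ^ (n + 1))) z := by
  have hc : Real.cosh (a * z + b) ≠ 0 := (Real.cosh_pos _).ne'
  have hlin : HasDerivAt (fun z : ℝ => a * z + b) a z := by
    simpa using ((hasDerivAt_id z).const_mul a).add_const b
  have h := (hlin.cosh.fun_inv hc).fun_pow n
  simp only [one_div]
  refine h.congr_deriv ?_
  rcases n with _ | n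
  · simp
  · rw [Nat.add_sub_cancel, div_eq_mul_inv, ← inv_pow]
    ring

lemma iteratedDeriv_two_sech_affine_pow (a b : ℝ) (n : ℕ) :
    iteratedDeriv 2 (fun z => (1 / Real.cosh (a * z + b)) ^ n) = fun z =>
      a ^ 2 * (n ^ 2 * (1 / Real.cosh (a * z + b)) ^ n
        - n * (n + 1) * (1 / Real.cosh (a * z + b)) ^ (n + 2)) := by
  have h1 : deriv (fun z => (1 / Real.cosh (a * z + b)) ^ n) = fun z =>
      -(n * a) * (Real.sinh (a * z + b) * (1 / Real.cosh (a * z + b)) ^ (n + 1)) :=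
    funext fun z => (hasDerivAt_sech_affine_pow a b z n).deriv
  rw [iteratedDeriv_succ, iteratedDeriv_one, h1]
  funext z
  have hc : Real.cosh (a * z + b) ≠ 0 := (Real.cosh_pos _).ne'
  have hlin : HasDerivAt (fun z : ℝ => a * z + b) a z := by
    simpa using ((hasDerivAt_id z).const_mul a).add_const b
  have h := (hlin.sinh.fun_mul (hasDerivAt_sech_affine_pow a b z (n + 1))).const_mul (-(n * a))
  rw [h.deriv]
  push_cast
  have hs := Real.cosh_sq (a * z + b)
  have hmul : Real.cosh (a * z + b) * (1 / Real.cosh (a * z + b)) = 1 := by field_simp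
  generalize 1 / Real.cosh (a * z + b) = s at *
  generalize Real.cosh (a * z + b) = C at *
  generalize Real.sinh (a * z + b) = H at *
  have hC : s * C = 1 := by rw [mul_comm]; exact hmul
  have e : H ^ 2 = C ^ 2 - 1 := by linarith
  have e1 : C * s ^ (n + 1) = s ^ n := by rw [pow_succ]; linear_combination s ^ n * hC
  have e2 : H ^ 2 * s ^ (n + 2) = s ^ n - s ^ (n + 2) := by
    rw [e, pow_add]; linear_combination s ^ n * (s * C + 1) * hC
  linear_combination (-(n * a ^ 2) : ℝ) * e1 + (n * a ^ 2 * (n + 1) : ℝ) * e2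

lemma iteratedDeriv_four_sech_affine_sq (a b z : ℝ) :
    iteratedDeriv 4 (fun z => (1 / Real.cosh (a * z + b)) ^ 2) z =
      a ^ 4 * (16 * (1 / Real.cosh (a * z + b)) ^ 2 - 120 * (1 / Real.cosh (a * z + b)) ^ 4
        + 120 * (1 / Real.cosh (a * z + b)) ^ 6) := by
  have hsmooth (n : ℕ) :
      ContDiffAt ℝ 2 (fun z => (1 / Real.cosh (a * z + b)) ^ n) z := by
    have hc : Real.cosh (a * z + b) ≠ 0 := (Real.cosh_pos _).ne'
    have hcosh : ContDiffAt ℝ 2 (fun z => Real.cosh (a * z + b)) z := by fun_prop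
    exact (contDiffAt_const.fun_div hcosh hc).pow n
  have h4 (f : ℝ → ℝ) : iteratedDeriv 4 f = iteratedDeriv 2 (iteratedDeriv 2 f) := by
    simp only [iteratedDeriv_eq_iterate, ← Function.iterate_add_apply]
  rw [h4, iteratedDeriv_two_sech_affine_pow, iteratedDeriv_const_mul_field,
    iteratedDeriv_fun_sub (contDiffAt_const.mul (hsmooth _)) (contDiffAt_const.mul (hsmooth _)),
    iteratedDeriv_const_mul_field, iteratedDeriv_const_mul_field,
    iteratedDeriv_two_sech_affine_pow, iteratedDeriv_two_sech_affine_pow]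
  push_cast
  ring

/-- For 0 < c < 1, u(x,t) = (c/2) sech²[(√c/2)(x − √(1−c) t + 1)]
    solves u_tt − u_xx + 3 (u²)_xx + u_xxxx = 0. -/
theorem boussinesq_example_solution
    (c : ℝ) (hc0 : 0 < c) (hc1 : c < 1)
    (u : ℝ → ℝ → ℝ)
    (hu : ∀ x t, u x t =
      (c / 2) * (1 / Real.cosh ((Real.sqrt c / 2) * (x - Real.sqrt (1 - c) * t + 1))) ^ 2) :
    ∀ x t : ℝ,
      iteratedDeriv 2 (fun t' => u x t') t
        - iteratedDeriv 2 (fun x' => u x' t) x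
        + 3 * iteratedDeriv 2 (fun x' => (u x' t) ^ 2) x
        + iteratedDeriv 4 (fun x' => u x' t) x = 0 := by
  intro x t
  set k := Real.sqrt c / 2 with hk
  set v := Real.sqrt (1 - c) with hv
  have hk2 : k ^ 2 = c / 4 := by rw [hk, div_pow, Real.sq_sqrt hc0.le]; norm_num
  have hv2 : v ^ 2 = 1 - c := Real.sq_sqrt (by linarith)
  have ht : (fun t' => u x t') = fun t' =>
      c / 2 * (1 / Real.cosh (-(k * v) * t' + k * (x + 1))) ^ 2 := by
    funext t'; rw [hu]; ring_nf
  have hx : (fun x' => u x' t) = fun x' =>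
      c / 2 * (1 / Real.cosh (k * x' + k * (1 - v * t))) ^ 2 := by
    funext x'; rw [hu]; ring_nf
  have hxx : (fun x' => (u x' t) ^ 2) = fun x' =>
      (c / 2) ^ 2 * (1 / Real.cosh (k * x' + k * (1 - v * t))) ^ 4 := by
    funext x'; rw [congrFun hx x']; ring
  rw [hxx, hx, ht]
  simp only [iteratedDeriv_const_mul_field, iteratedDeriv_two_sech_affine_pow,
    iteratedDeriv_four_sech_affine_sq]
  have harg : -(k * v) * t + k * (x + 1) = k * x + k * (1 - v * t) := by ring
  rw [harg]
  generalize 1 / Real.cosh (k * x + k * (1 - v * t)) = s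
  have hk4 : k ^ 4 = (c / 4) ^ 2 := by rw [← hk2]; ring
  have hkv : (-(k * v)) ^ 2 = c / 4 * (1 - c) := by rw [← hk2, ← hv2]; ring
  rw [hkv, hk4, hk2]
  push_cast
  ring
end

section
/- Let X be a real vector space, f₁, f₂ ∈ X, L : X → X a linear map, and N : X → X any map. Define the modified DJM sequence u : ℕ → X by u₀ = f₁, u₁ = f₂ + L(u₀) + N(u₀), and u_{m+1} = L(u_m) + N(S_m) − N(S_{m−1}) for m ≥ 1, where S_n = u₀ + u₁ + ⋯ + u_n. Then for every n ≥ 0, the partial sums satisfy S_{n+1} = (f₁ + f₂) + L(S_n) + N(S_n). -/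
/-- Partial sums of the modified DJM series satisfy
    S_{n+1} = (f₁ + f₂) + L(S_n) + N(S_n). -/
theorem mdjm_partial_sums
    {X : Type*} [AddCommGroup X] [Module ℝ X]
    (f₁ f₂ : X) (L : X →ₗ[ℝ] X) (N : X → X)
    (u : ℕ → X) (S : ℕ → X)
    (hS : ∀ n, S n = ∑ i ∈ Finset.range (n + 1), u i)
    (h0 : u 0 = f₁)
    (h1 : u 1 = f₂ + L (u 0) + N (u 0))
    (hrec : ∀ m : ℕ, 1 ≤ m → u (m + 1) = L (u m) + N (S m) - N (S (m - 1))) :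
    ∀ n : ℕ, S (n + 1) = (f₁ + f₂) + L (S n) + N (S n) := by
  have hsucc : ∀ n, S (n + 1) = S n + u (n + 1) := fun n => by
    rw [hS, hS, Finset.sum_range_succ]
  have hS0 : S 0 = u 0 := by simp [hS]
  intro n
  induction n with
  | zero =>
    rw [hsucc, hS0, zero_add, h1, h0]
    abel
  | succ k ih =>
    rw [hsucc (k + 1), hrec (k + 1) (Nat.le_add_left 1 k), Nat.add_sub_cancel]
    have hL : L (S (k + 1)) = L (S k) + L (u (k + 1)) := by rw [hsucc, map_add]
    rw [hL]
    nth_rewrite 1 [ih]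
    abel
end

section
/- Let X be a real Banach space, f ∈ X, L : X → X a continuous linear map, and N : X → X a continuous map. Define the DJM sequence u : ℕ → X by u₀ = f, u₁ = L(u₀) + N(u₀), and u_{m+1} = L(u_m) + N(S_m) − N(S_{m−1}) for m ≥ 1, where S_n = u₀ + ⋯ + u_n. If the series Σ_{i=0}^{∞} u_i converges to an element u ∈ X, then u satisfies the functional equation u = f + L(u) + N(u). -/
/-- If the DJM series converges, its sum solves
    u = f + L(u) + N(u). -/
theorem djm_limit_solves_equation
    {X : Type*} [NormedAddCommGroup X] [NormedSpace ℝ X] [CompleteSpace X]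
    (f : X) (L : X →L[ℝ] X) (N : X → X) (hN : Continuous N)
    (u : ℕ → X) (S : ℕ → X)
    (hS : ∀ n, S n = ∑ i ∈ Finset.range (n + 1), u i)
    (h0 : u 0 = f)
    (h1 : u 1 = L (u 0) + N (u 0))
    (hrec : ∀ m : ℕ, 1 ≤ m → u (m + 1) = L (u m) + N (S m) - N (S (m - 1)))
    (s : X) (hconv : Filter.Tendsto S Filter.atTop (nhds s)) :
    s = f + L s + N s := by
  have hstep : ∀ n, S (n + 1) = f + L (S n) + N (S n) := by
    intro n
    induction n with
    | zero =>
      have hS0 : S 0 = u 0 := by simp [hS]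
      rw [hS (0 + 1), Finset.sum_range_succ, ← hS 0, hS0, h1, h0, add_assoc]
    | succ k ih =>
      have hsucc : S (k + 1) = S k + u (k + 1) := by
        rw [hS (k + 1), Finset.sum_range_succ, ← hS k]
      have hL : L (S (k + 1)) = L (S k) + L (u (k + 1)) := by rw [hsucc, map_add]
      rw [hS (k + 1 + 1), Finset.sum_range_succ, ← hS (k + 1), hrec (k + 1) k.succ_pos,
        Nat.add_sub_cancel, hL]
      nth_rewrite 1 [ih]
      abel
  have hleft : Filter.Tendsto (fun n => S (n + 1)) Filter.atTop (nhds s) :=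
    hconv.comp (Filter.tendsto_add_atTop_nat 1)
  have hright : Filter.Tendsto (fun n => f + L (S n) + N (S n)) Filter.atTop
      (nhds (f + L s + N s)) :=
    (tendsto_const_nhds.add ((L.continuous.tendsto s).comp hconv)).add
      ((hN.tendsto s).comp hconv)
  exact tendsto_nhds_unique hleft (hright.congr fun n => (hstep n).symm)
end
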